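/- Let ξ = (ξ_n)_{n≥0} be a time-homogeneous two-state Markov chain with state space X = {0,1}: there is an initial distribution p₀ on X and a transition function π : X × X → [0,1] with π(x,0) + π(x,1) = 1 for each x, such that for every n ≥ 0 and every x_0, …, x_n ∈ X the joint probability satisfies P(ξ_0 = x_0, ξ_1 = x_1, …, ξ_n = x_n) = p₀(x_0) · ∏_{i=1}^{n} π(x_{i-1}, x_i). Assume π(x,y) ≠ 0 for all x,y ∈ X, π(0,0) ≠ π(1,1), and π(0,0) + π(1,1) ≠ 1. Then for every x ∈ X and every n ≥ 0 there exists a sequence of natural numbers (s_p)_{p≥1} with 0 ≤ s_p ≤ p, s_p → ∞ as p → ∞, and ∑_{p≥1} s_p·2^{-s_p} = ∞ (so that the set E = ⋃_{p≥1} {k : 2^p ≤ k < 2^{p+1} and ν(k) ≥ s_p} is a thick set), such that lim_{k→∞, k∈E} P(ξ_n^{(k)} = x) = 1/2. -/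

import Mathlib

open scoped ENNReal

/-- `nu k` is ν(k): the number of trailing 1-bits of `k`, i.e. the maximal `m ≥ 0` such that
the binary digits `ε_0, …, ε_{m-1}` of `k` are all `1`; equivalently the 2-adic valuation
of `k + 1`. -/
def nu (k : ℕ) : ℕ := padicValNat 2 (k + 1)

/-- The discrete capacity `C(e) = ∑_{k ∈ e} ν(k)`, valued in `[0, ∞]`. -/
noncomputable def cap (e : Set ℕ) : ℝ≥0∞ := ∑' k : e, (nu k : ℝ≥0∞)

/-- The dyadic block `K_p = {k : 2^p ≤ k < 2^(p+1)}`. -/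
def Kblock (p : ℕ) : Set ℕ := {k : ℕ | 2 ^ p ≤ k ∧ k < 2 ^ (p + 1)}

/-- A set `e ⊆ ℕ` is thin if `∑_{p=1}^∞ 2^{-p} C(e ∩ K_p) < ∞`. -/
def Thin (e : Set ℕ) : Prop :=
  ∑' p : ℕ, cap (e ∩ Kblock (p + 1)) / 2 ^ (p + 1) ≠ ⊤

/-- A set `e ⊆ ℕ` is thick if it is not thin. -/
def Thick (e : Set ℕ) : Prop := ¬ Thin e

open MeasureTheory Filter

/-- Higher-order absolute differences of a process: `hdiffP ξ 0 = ξ` and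
`hdiffP ξ (k+1) n ω = |hdiffP ξ k (n+1) ω - hdiffP ξ k n ω|`. -/
def hdiffP {Ω : Type*} (ξ : ℕ → Ω → ℕ) : ℕ → ℕ → Ω → ℕ
  | 0 => ξ
  | (k + 1) => fun n ω => Nat.dist (hdiffP ξ k (n + 1) ω) (hdiffP ξ k n ω)

lemma aux_contr (a b : ℝ) (ha : 0 < a) (ha1 : a < 1) (hb : 0 < b) (hb1 : b < 1) :
    ∃ r : ℝ, 0 ≤ r ∧ r < 1 ∧ ∀ v w : ℝ,
      |a * (a * v + (1 - b) * w) + (1 - b) * (-((1 - a) * v + b * w))|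
        + |-((1 - a) * (a * v + (1 - b) * w) + b * (-((1 - a) * v + b * w)))|
        ≤ r * (|v| + |w|) := by
  have key : ∀ a b : ℝ, 0 < a → a < 1 → 0 < b → b < 1 →
      |a ^ 2 - (1 - a) * (1 - b)| + |(1 - a) * (a - b)| < 1 := by
    intro a b ha ha1 hb hb1
    have h1 : 0 < a ^ 2 := by positivity
    have h2 : 0 < (1 - a) * (1 - b) := mul_pos (by linarith) (by linarith)
    have h3 : |a ^ 2 - (1 - a) * (1 - b)| < a ^ 2 + (1 - a) * (1 - b) := by
      rw [abs_lt]; constructor <;> linarith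
    have h4 : |(1 - a) * (a - b)| ≤ (1 - a) * (a + b) := by
      rw [abs_mul, abs_of_pos (by linarith : 0 < 1 - a)]
      apply mul_le_mul_of_nonneg_left _ (by linarith)
      rw [abs_le]; constructor <;> linarith
    nlinarith
  have k1 := key a b ha ha1 hb hb1
  have k2 := key b a hb hb1 ha ha1
  set r1 := |a ^ 2 - (1 - a) * (1 - b)| + |(1 - a) * (a - b)| with hr1
  set r2 := |b ^ 2 - (1 - b) * (1 - a)| + |(1 - b) * (b - a)| with hr2
  refine ⟨max r1 r2, le_max_of_le_left (by positivity), max_lt k1 k2, fun v w => ?_⟩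
  have e1 : a * (a * v + (1 - b) * w) + (1 - b) * (-((1 - a) * v + b * w))
      = (a ^ 2 - (1 - a) * (1 - b)) * v + -((1 - b) * (b - a)) * w := by ring
  have e2 : -((1 - a) * (a * v + (1 - b) * w) + b * (-((1 - a) * v + b * w)))
      = -((1 - a) * (a - b)) * v + (b ^ 2 - (1 - b) * (1 - a)) * w := by ring
  rw [e1, e2]
  have a1 := abs_add_le ((a ^ 2 - (1 - a) * (1 - b)) * v) (-((1 - b) * (b - a)) * w)
  have a2 := abs_add_le (-((1 - a) * (a - b)) * v) ((b ^ 2 - (1 - b) * (1 - a)) * w)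
  rw [abs_mul, abs_mul, abs_neg] at a1 a2
  have m1 : r1 * |v| ≤ max r1 r2 * |v| :=
    mul_le_mul_of_nonneg_right (le_max_left _ _) (abs_nonneg _)
  have m2 : r2 * |w| ≤ max r1 r2 * |w| :=
    mul_le_mul_of_nonneg_right (le_max_right _ _) (abs_nonneg _)
  have x1 : r1 * |v| = |a ^ 2 - (1 - a) * (1 - b)| * |v| + |(1 - a) * (a - b)| * |v| := by
    rw [hr1]; ring
  have x2 : r2 * |w| = |b ^ 2 - (1 - b) * (1 - a)| * |w| + |(1 - b) * (b - a)| * |w| := by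
    rw [hr2]; ring
  linarith

lemma aux_step (a b v w : ℝ) (ha : 0 < a) (ha1 : a < 1) (hb : 0 < b) (hb1 : b < 1) :
    |a * v + (1 - b) * w| + |(1 - a) * v + b * w| ≤ |v| + |w| := by
  have a1 := abs_add_le (a * v) ((1 - b) * w)
  have a2 := abs_add_le ((1 - a) * v) (b * w)
  rw [abs_mul, abs_mul] at a1 a2
  rw [abs_of_pos ha, abs_of_pos (by linarith : 0 < 1 - b)] at a1
  rw [abs_of_pos hb, abs_of_pos (by linarith : 0 < 1 - a)] at a2
  linarith

lemma aux_choose_odd (k s : ℕ) (h : 2 ^ s ∣ k + 1) : ∀ j, j < 2 ^ s → Odd (k.choose j) := by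
  intro j
  induction j with
  | zero => intro _; simp
  | succ j ih =>
    intro hj
    have h1 := ih (by omega)
    have h2 : Even ((k + 1).choose (j + 1)) := by
      have e := Nat.add_one_mul_choose_eq k j
      by_contra hodd
      rw [Nat.not_even_iff_odd] at hodd
      have : 2 ^ s ∣ (k + 1).choose (j + 1) * (j + 1) := e ▸ Dvd.dvd.mul_right h _
      have hc : Nat.Coprime (2 ^ s) ((k + 1).choose (j + 1)) :=
        Nat.Coprime.pow_left _ (Nat.coprime_two_left.mpr hodd)
      have := Nat.le_of_dvd (by omega) (hc.dvd_of_dvd_mul_left this)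
      omega
    rw [Nat.choose_succ_succ] at h2
    rcases h1 with ⟨t, ht⟩
    rcases h2 with ⟨u, hu⟩
    rw [← Nat.not_even_iff_odd]
    rintro ⟨v, hv⟩
    simp only [Nat.succ_eq_add_one] at hu
    omega

lemma aux_hdiff_sum {Ω : Type*} (ξ : ℕ → Ω → ℕ) (ω : Ω) (k : ℕ) : ∀ n,
    (hdiffP ξ k n ω : ZMod 2) = ∑ j ∈ Finset.range (k + 1), (k.choose j : ZMod 2) * ξ (n + j) ω := by
  induction k with
  | zero => intro n; simp [hdiffP]
  | succ k ih =>
    intro n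
    have hd : ∀ a b : ℕ, ((Nat.dist a b : ℕ) : ZMod 2) = a + b := by
      intro a b
      rw [← Nat.cast_add, ZMod.natCast_eq_natCast_iff']
      unfold Nat.dist; omega
    simp only [hdiffP]
    rw [hd, ih, ih, Finset.sum_range_succ' _ (k + 1)]
    conv_lhs => rw [Finset.sum_range_succ' (fun j => (k.choose j : ZMod 2) * ξ (n + j) ω) k]
    simp only [Nat.choose_succ_succ, Nat.cast_add, add_mul, Finset.sum_add_distrib,
      Nat.succ_eq_add_one]
    rw [Finset.sum_range_succ (fun x => ((k.choose (x+1) : ℕ) : ZMod 2) * _)]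
    have hsh : ∀ x, n + 1 + x = n + (x + 1) := fun x => by omega
    simp only [hsh, Nat.choose_succ_self, Nat.choose_zero_right]
    push_cast
    ring

lemma aux_hdiff_val {Ω : Type*} (ξ : ℕ → Ω → ℕ) (hval : ∀ n ω, ξ n ω = 0 ∨ ξ n ω = 1) (ω : Ω)
    (k : ℕ) : ∀ n, hdiffP ξ k n ω = 0 ∨ hdiffP ξ k n ω = 1 := by
  induction k with
  | zero => intro n; exact hval n ω
  | succ k ih =>
    intro n
    have h1 := ih n
    have h2 := ih (n + 1)
    simp only [hdiffP, Nat.dist]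
    omega

lemma aux_sign {Ω : Type*} (ξ : ℕ → Ω → ℕ) (ω : Ω) (k n : ℕ) :
    (-1 : ℝ) ^ (hdiffP ξ k n ω) =
    (-1 : ℝ) ^ (∑ i ∈ Finset.range (n + k + 1), (if i < n then 0 else k.choose (i - n)) * ξ i ω) := by
  have e : ∑ i ∈ Finset.range (n + k + 1), (if i < n then 0 else k.choose (i - n)) * ξ i ω
      = ∑ j ∈ Finset.range (k + 1), k.choose j * ξ (n + j) ω := by
    rw [add_assoc, Finset.sum_range_add]
    rw [Finset.sum_eq_zero, zero_add]
    · apply Finset.sum_congr rfl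
      intro j _
      simp
    · intro i hi
      simp [Finset.mem_range.mp hi]
  rw [e]
  have h := aux_hdiff_sum ξ ω k n
  have h2 : ((hdiffP ξ k n ω : ℕ) : ZMod 2) =
    ((∑ j ∈ Finset.range (k + 1), k.choose j * ξ (n + j) ω : ℕ) : ZMod 2) := by
    rw [h]; push_cast; rfl
  rw [ZMod.natCast_eq_natCast_iff'] at h2
  rw [neg_one_pow_eq_pow_mod_two, h2, ← neg_one_pow_eq_pow_mod_two]

lemma aux_markov {Ω : Type*} [MeasurableSpace Ω] (P : Measure Ω) [IsProbabilityMeasure P]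
    (ξ : ℕ → Ω → ℕ) (hmeas : ∀ n, Measurable (ξ n))
    (hval : ∀ n ω, ξ n ω = 0 ∨ ξ n ω = 1)
    (p0 : ℕ → ℝ≥0∞) (π : ℕ → ℕ → ℝ≥0∞)
    (hjoint : ∀ n : ℕ, ∀ x : ℕ → ℕ, (∀ i, i ≤ n → x i = 0 ∨ x i = 1) →
      P {ω | ∀ i, i ≤ n → ξ i ω = x i}
        = p0 (x 0) * ∏ i ∈ Finset.Icc 1 n, π (x (i - 1)) (x i))
    (m x y : ℕ) (hy : y = 0 ∨ y = 1) :
    (P.restrict {ω | ξ m ω = x ∧ ξ (m + 1) ω = y}).map (fun ω (i : Fin (m + 1)) => ξ i ω)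
      = π x y • (P.restrict {ω | ξ m ω = x}).map (fun ω (i : Fin (m + 1)) => ξ i ω) := by
  have hF : Measurable (fun ω (i : Fin (m + 1)) => ξ i ω) :=
    measurable_pi_lambda _ fun i => hmeas i
  apply Measure.ext_of_singleton
  intro f
  have hs : MeasurableSet ((fun ω (i : Fin (m + 1)) => ξ i ω) ⁻¹' {f}) :=
    hF (measurableSet_singleton f)
  rw [Measure.smul_apply, Measure.map_apply hF (measurableSet_singleton f),
    Measure.map_apply hF (measurableSet_singleton f), Measure.restrict_apply hs,
    Measure.restrict_apply hs, smul_eq_mul]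
  by_cases hf : (∀ i, f i = 0 ∨ f i = 1) ∧ f (Fin.last m) = x
  · obtain ⟨hf, hx⟩ := hf
    set g : ℕ → ℕ := fun i => if h : i < m + 1 then f ⟨i, h⟩ else y with hg
    have hgv : ∀ i, g i = 0 ∨ g i = 1 := by
      intro i
      simp only [hg]
      split_ifs
      · exact hf _
      · exact hy
    have gm : g m = x := by simp only [hg]; rw [dif_pos (by omega)]; exact hx
    have gm1 : g (m + 1) = y := by simp [hg]
    have h1 := hjoint m g (fun i _ => hgv i)
    have h2 := hjoint (m + 1) g (fun i _ => hgv i)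
    have s1 : ((fun ω (i : Fin (m + 1)) => ξ i ω) ⁻¹' {f}) ∩ {ω | ξ m ω = x}
        = {ω | ∀ i, i ≤ m → ξ i ω = g i} := by
      ext ω
      simp only [Set.mem_inter_iff, Set.mem_preimage, Set.mem_singleton_iff, Set.mem_ofPred_eq]
      constructor
      · rintro ⟨h, _⟩ i hi
        simp only [hg]
        rw [dif_pos (by omega), ← h]
      · intro h
        refine ⟨?_, by rw [h m le_rfl, gm]⟩
        funext i
        rw [h i (by omega)]
        simp only [hg]
        rw [dif_pos i.2]
    have s2 : ((fun ω (i : Fin (m + 1)) => ξ i ω) ⁻¹' {f}) ∩ {ω | ξ m ω = x ∧ ξ (m + 1) ω = y}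
        = {ω | ∀ i, i ≤ m + 1 → ξ i ω = g i} := by
      have : {ω | ξ m ω = x ∧ ξ (m + 1) ω = y} = {ω | ξ m ω = x} ∩ {ω | ξ (m + 1) ω = y} := rfl
      rw [this, ← Set.inter_assoc, s1]
      ext ω
      simp only [Set.mem_inter_iff, Set.mem_ofPred_eq]
      constructor
      · rintro ⟨h, h'⟩ i hi
        rcases Nat.lt_or_ge m i with h3 | h3
        · obtain rfl : i = m + 1 := by omega
          rw [h', gm1]
        · exact h i h3
      · intro h
        exact ⟨fun i hi => h i (by omega), by rw [h _ le_rfl, gm1]⟩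
    rw [s1, s2, h1, h2, Finset.prod_Icc_succ_top (by omega)]
    simp only [Nat.add_sub_cancel, gm, gm1]
    ring
  · have : ((fun ω (i : Fin (m + 1)) => ξ i ω) ⁻¹' {f}) ∩ {ω | ξ m ω = x} = ∅ := by
      ext ω
      simp only [Set.mem_inter_iff, Set.mem_preimage, Set.mem_singleton_iff, Set.mem_ofPred_eq,
        Set.mem_empty_iff_false, iff_false]
      rintro ⟨h, h'⟩
      apply hf
      subst h
      exact ⟨fun i => hval i ω, by simpa using h'⟩
    have h2 : ((fun ω (i : Fin (m + 1)) => ξ i ω) ⁻¹' {f}) ∩ {ω | ξ m ω = x ∧ ξ (m + 1) ω = y} = ∅ := by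
      rw [← Set.subset_empty_iff, ← this]
      exact Set.inter_subset_inter_right _ fun ω h => h.1
    rw [this, h2]; simp

/-- signed mass at time `m` and state `y` -/
noncomputable def sgnMass {Ω : Type*} [MeasurableSpace Ω] (P : Measure Ω)
    (ξ : ℕ → Ω → ℕ) (c : ℕ → ℕ) (m y : ℕ) : ℝ :=
  ∫ ω in {ω | ξ m ω = y}, (-1 : ℝ) ^ (∑ i ∈ Finset.range (m + 1), c i * ξ i ω) ∂P

lemma aux_int {Ω : Type*} [MeasurableSpace Ω] (P : Measure Ω) [IsFiniteMeasure P]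
    (ξ : ℕ → Ω → ℕ) (hmeas : ∀ n, Measurable (ξ n)) (c : ℕ → ℕ) (m : ℕ) :
    Integrable (fun ω => (-1 : ℝ) ^ (∑ i ∈ Finset.range m, c i * ξ i ω)) P := by
  apply Integrable.of_bound (C := 1)
  · apply Measurable.aestronglyMeasurable
    have : Measurable (fun ω => ∑ i ∈ Finset.range m, c i * ξ i ω) :=
      Finset.measurable_sum _ fun i _ => (hmeas i).const_mul _
    exact (measurable_from_nat (f := fun t : ℕ => (-1 : ℝ) ^ t)).comp this
  · filter_upwards with ω
    simp

lemma aux_split {Ω : Type*} [MeasurableSpace Ω] (P : Measure Ω) (f : Ω → ℝ) (hf : Integrable f P)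
    (η : Ω → ℕ) (hη : Measurable η) (hv : ∀ ω, η ω = 0 ∨ η ω = 1) :
    ∫ ω, f ω ∂P = (∫ ω in {ω | η ω = 0}, f ω ∂P) + ∫ ω in {ω | η ω = 1}, f ω ∂P := by
  have h0 : MeasurableSet {ω | η ω = 0} := hη (measurableSet_singleton 0)
  have : {ω | η ω = 1} = {ω | η ω = 0}ᶜ := by
    ext ω
    have := hv ω
    simp only [Set.mem_ofPred_eq, Set.mem_compl_iff]
    omega
  rw [this, integral_add_compl h0 hf]

lemma aux_rec {Ω : Type*} [MeasurableSpace Ω] (P : Measure Ω) [IsProbabilityMeasure P]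
    (ξ : ℕ → Ω → ℕ) (hmeas : ∀ n, Measurable (ξ n))
    (hval : ∀ n ω, ξ n ω = 0 ∨ ξ n ω = 1)
    (p0 : ℕ → ℝ≥0∞) (π : ℕ → ℕ → ℝ≥0∞)
    (hjoint : ∀ n : ℕ, ∀ x : ℕ → ℕ, (∀ i, i ≤ n → x i = 0 ∨ x i = 1) →
      P {ω | ∀ i, i ≤ n → ξ i ω = x i}
        = p0 (x 0) * ∏ i ∈ Finset.Icc 1 n, π (x (i - 1)) (x i))
    (c : ℕ → ℕ) (m y : ℕ) (hy : y = 0 ∨ y = 1) :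
    sgnMass P ξ c (m + 1) y = (-1 : ℝ) ^ (c (m + 1) * y) *
      ((π 0 y).toReal * sgnMass P ξ c m 0 + (π 1 y).toReal * sgnMass P ξ c m 1) := by
  have hF : Measurable (fun ω (i : Fin (m + 1)) => ξ i ω) :=
    measurable_pi_lambda _ fun i => hmeas i
  have hms : ∀ k x, MeasurableSet {ω | ξ k ω = x} := fun k x => hmeas k (measurableSet_singleton x)
  have key : ∀ x, ∫ ω in {ω | ξ m ω = x ∧ ξ (m + 1) ω = y},
      (-1 : ℝ) ^ (∑ i ∈ Finset.range (m + 1), c i * ξ i ω) ∂P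
      = (π x y).toReal * sgnMass P ξ c m x := by
    intro x
    have h := aux_markov P ξ hmeas hval p0 π hjoint m x y hy
    have hG : Measurable (fun f : Fin (m + 1) → ℕ => (-1 : ℝ) ^ (∑ i : Fin (m + 1), c i * f i)) :=
      measurable_of_countable _
    have h2 := congrArg (fun μ => ∫ f, (-1 : ℝ) ^ (∑ i : Fin (m + 1), c i * f i) ∂μ) h
    beta_reduce at h2
    rw [integral_smul_measure, integral_map hF.aemeasurable hG.aestronglyMeasurable,
      integral_map hF.aemeasurable hG.aestronglyMeasurable] at h2
    simp only [fun ω => Fin.sum_univ_eq_sum_range (fun i => c i * ξ i ω) (m + 1)] at h2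
    rw [h2, smul_eq_mul]; rfl
  unfold sgnMass at key ⊢
  have e1 : ∫ ω in {ω | ξ (m + 1) ω = y},
      (-1 : ℝ) ^ (∑ i ∈ Finset.range (m + 1 + 1), c i * ξ i ω) ∂P
      = ∫ ω in {ω | ξ (m + 1) ω = y}, (-1 : ℝ) ^ (c (m + 1) * y) *
        (-1 : ℝ) ^ (∑ i ∈ Finset.range (m + 1), c i * ξ i ω) ∂P := by
    apply setIntegral_congr_fun (hms _ _)
    intro ω hω
    have hω' : ξ (m + 1) ω = y := hω
    simp only
    rw [Finset.sum_range_succ, pow_add, hω', mul_comm]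
  rw [e1, integral_const_mul, aux_split _ _ (aux_int _ ξ hmeas c (m + 1)) (ξ m) (hmeas m) (hval m),
    Measure.restrict_restrict (hms _ _), Measure.restrict_restrict (hms _ _)]
  rw [← key 0, ← key 1]
  rfl

lemma aux_ptoReal {a b : ℝ≥0∞} (h : a + b = 1) : b.toReal = 1 - a.toReal := by
  have ha : a ≠ ⊤ := fun h' => by simp [h'] at h
  have hb : b ≠ ⊤ := fun h' => by simp [h'] at h
  have := congrArg ENNReal.toReal h
  rw [ENNReal.toReal_add ha hb, ENNReal.toReal_one] at this
  linarith

lemma aux_bound {Ω : Type*} [MeasurableSpace Ω] (P : Measure Ω) [IsProbabilityMeasure P]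
    (ξ : ℕ → Ω → ℕ) (hmeas : ∀ n, Measurable (ξ n))
    (hval : ∀ n ω, ξ n ω = 0 ∨ ξ n ω = 1)
    (p0 : ℕ → ℝ≥0∞) (π : ℕ → ℕ → ℝ≥0∞)
    (hπrow : ∀ x, x = 0 ∨ x = 1 → π x 0 + π x 1 = 1)
    (hjoint : ∀ n : ℕ, ∀ x : ℕ → ℕ, (∀ i, i ≤ n → x i = 0 ∨ x i = 1) →
      P {ω | ∀ i, i ≤ n → ξ i ω = x i}
        = p0 (x 0) * ∏ i ∈ Finset.Icc 1 n, π (x (i - 1)) (x i))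
    (hπne : ∀ x y, (x = 0 ∨ x = 1) → (y = 0 ∨ y = 1) → π x y ≠ 0) :
    ∃ r : ℝ, 0 ≤ r ∧ r < 1 ∧ ∀ n k t : ℕ, 2 * t + 1 ≤ 2 ^ nu k →
      |∫ ω, (-1 : ℝ) ^ (hdiffP ξ k n ω) ∂P| ≤ r ^ t := by
  set a := (π 0 0).toReal with ha
  set b := (π 1 1).toReal with hb
  have r0 := hπrow 0 (Or.inl rfl)
  have r1 := hπrow 1 (Or.inr rfl)
  have e01 : (π 0 1).toReal = 1 - a := aux_ptoReal r0
  have e10 : (π 1 0).toReal = 1 - b := aux_ptoReal (by rw [add_comm]; exact r1)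
  have hpos : ∀ x y, (x = 0 ∨ x = 1) → (y = 0 ∨ y = 1) → 0 < (π x y).toReal := by
    intro x y hx hy
    apply ENNReal.toReal_pos (hπne x y hx hy)
    intro h
    have := hπrow x hx
    rcases hy with rfl | rfl <;> simp [h] at this
  have ha0 : 0 < a := hpos 0 0 (by simp) (by simp)
  have hb0 : 0 < b := hpos 1 1 (by simp) (by simp)
  have ha1 : a < 1 := by have := hpos 0 1 (by simp) (by simp); linarith
  have hb1 : b < 1 := by have := hpos 1 0 (by simp) (by simp); linarith
  obtain ⟨r, hr0, hr1, hr⟩ := aux_contr a b ha0 ha1 hb0 hb1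
  refine ⟨r, hr0, hr1, fun n k t ht => ?_⟩
  set c : ℕ → ℕ := fun i => if i < n then 0 else k.choose (i - n) with hc
  have hodd : ∀ i, n ≤ i → i < n + 2 ^ nu k → Odd (c i) := by
    intro i h1 h2
    simp only [hc]
    rw [if_neg (by omega)]
    exact aux_choose_odd k (nu k) pow_padicValNat_dvd _ (by omega)
  have rec0 : ∀ m, sgnMass P ξ c (m + 1) 0
      = a * sgnMass P ξ c m 0 + (1 - b) * sgnMass P ξ c m 1 := by
    intro m
    rw [aux_rec P ξ hmeas hval p0 π hjoint c m 0 (by simp), e10]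
    simp [ha]
  have rec1 : ∀ m, sgnMass P ξ c (m + 1) 1 = (-1) ^ c (m + 1) *
      ((1 - a) * sgnMass P ξ c m 0 + b * sgnMass P ξ c m 1) := by
    intro m
    rw [aux_rec P ξ hmeas hval p0 π hjoint c m 1 (by simp), e01, mul_one]
  set N : ℕ → ℝ := fun m => |sgnMass P ξ c m 0| + |sgnMass P ξ c m 1| with hN
  have mono : Antitone N := by
    apply antitone_nat_of_succ_le
    intro m
    simp only [hN]
    rw [rec0, rec1, abs_mul, abs_neg_one_pow, one_mul]
    exact aux_step a b _ _ ha0 ha1 hb0 hb1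
  have two : ∀ m, Odd (c (m + 1)) → Odd (c (m + 2)) → N (m + 2) ≤ r * N m := by
    intro m h1 h2
    have q1 := rec1 m
    have q2 := rec1 (m + 1)
    rw [h1.neg_one_pow, neg_one_mul] at q1
    rw [h2.neg_one_pow, neg_one_mul] at q2
    have := hr (sgnMass P ξ c m 0) (sgnMass P ξ c m 1)
    rw [← rec0, ← q1, ← rec0, ← q2] at this
    exact this
  have N0 : ∀ m, N m ≤ 1 := by
    intro m
    have hb : ∀ y, |sgnMass P ξ c m y| ≤ P.real {ω | ξ m ω = y} := by
      intro y
      have := norm_setIntegral_le_of_norm_le_const (μ := P) (s := {ω | ξ m ω = y}) (C := 1)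
        (f := fun ω => (-1 : ℝ) ^ (∑ i ∈ Finset.range (m + 1), c i * ξ i ω))
        (measure_lt_top _ _) (fun ω _ => by simp)
      simpa [sgnMass] using this
    have hs : P.real {ω | ξ m ω = 0} + P.real {ω | ξ m ω = 1} = 1 := by
      have := aux_split P (fun _ => (1 : ℝ)) (integrable_const _) (ξ m) (hmeas m) (hval m)
      simp at this
      linarith
    have := hb 0
    have := hb 1
    simp only [hN]
    linarith
  have pw : ∀ i, 2 * i + 1 ≤ 2 ^ nu k → N (n + 2 * i) ≤ r ^ i := by
    intro i
    induction i with
    | zero => intro _; simpa using N0 n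
    | succ i ih =>
      intro hi
      have h1 := ih (by omega)
      have h2 := two (n + 2 * i) (hodd _ (by omega) (by omega)) (hodd _ (by omega) (by omega))
      calc N (n + 2 * (i + 1)) ≤ r * N (n + 2 * i) := h2
        _ ≤ r * r ^ i := mul_le_mul_of_nonneg_left h1 hr0
        _ = r ^ (i + 1) := by ring
  have hle : 2 ^ nu k ≤ k + 1 := Nat.le_of_dvd (by omega) pow_padicValNat_dvd
  have hint : ∫ ω, (-1 : ℝ) ^ (hdiffP ξ k n ω) ∂P
      = sgnMass P ξ c (n + k) 0 + sgnMass P ξ c (n + k) 1 := by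
    simp only [aux_sign]
    exact aux_split P _ (aux_int P ξ hmeas c (n + k + 1)) (ξ (n + k)) (hmeas _) (hval _)
  rw [hint]
  calc _ ≤ N (n + k) := abs_add_le _ _
    _ ≤ N (n + 2 * t) := mono (by omega)
    _ ≤ r ^ t := pw t ht

lemma aux_hdiff_meas {Ω : Type*} [MeasurableSpace Ω] (ξ : ℕ → Ω → ℕ)
    (hmeas : ∀ n, Measurable (ξ n)) (k : ℕ) : ∀ n, Measurable (hdiffP ξ k n) := by
  induction k with
  | zero => exact hmeas
  | succ k ih =>
    intro n
    have h : Measurable (fun q : ℕ × ℕ => Nat.dist q.1 q.2) := measurable_of_countable _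
    exact h.comp ((ih (n + 1)).prodMk (ih n))

lemma aux_prob {Ω : Type*} [MeasurableSpace Ω] (P : Measure Ω) [IsProbabilityMeasure P]
    (η : Ω → ℕ) (hη : Measurable η) (hv : ∀ ω, η ω = 0 ∨ η ω = 1) (x : ℕ) (hx : x = 0 ∨ x = 1) :
    |(P {ω | η ω = x}).toReal - 1 / 2| ≤ |∫ ω, (-1 : ℝ) ^ (η ω) ∂P| := by
  have hs := aux_split P (fun _ => (1 : ℝ)) (integrable_const _) η hη hv
  simp at hs
  have hI : Integrable (fun ω => (-1 : ℝ) ^ (η ω)) P := by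
    apply Integrable.of_bound (C := 1)
    · apply Measurable.aestronglyMeasurable
      exact (measurable_from_nat (f := fun t : ℕ => (-1 : ℝ) ^ t)).comp hη
    · filter_upwards with ω
      simp
  have h2 := aux_split P _ hI η hη hv
  have e0 : ∫ ω in {ω | η ω = 0}, (-1 : ℝ) ^ (η ω) ∂P = P.real {ω | η ω = 0} := by
    rw [setIntegral_congr_fun (g := fun _ => (1 : ℝ)) (show MeasurableSet {ω | η ω = 0} from hη (measurableSet_singleton 0))]
    · simp
    · intro ω hω
      have : η ω = 0 := hω
      simp [this]
  have e1 : ∫ ω in {ω | η ω = 1}, (-1 : ℝ) ^ (η ω) ∂P = - P.real {ω | η ω = 1} := by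
    rw [setIntegral_congr_fun (g := fun _ => (-1 : ℝ)) (show MeasurableSet {ω | η ω = 1} from hη (measurableSet_singleton 1))]
    · simp
    · intro ω hω
      have : η ω = 1 := hω
      simp [this]
  rw [e0, e1] at h2
  rw [h2]
  change |P.real {ω | η ω = x} - 1 / 2| ≤ _
  have q1 := le_abs_self (P.real {ω | η ω = 0} + -P.real {ω | η ω = 1})
  have q2 := neg_abs_le (P.real {ω | η ω = 0} + -P.real {ω | η ω = 1})
  have q3 := abs_nonneg (P.real {ω | η ω = 0} + -P.real {ω | η ω = 1})
  rw [abs_le]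
  rcases hx with rfl | rfl <;> constructor <;> linarith

lemma aux_div : ∑' p : ℕ, ((Nat.log 2 (p + 1) : ℕ) : ℝ≥0∞) / 2 ^ (Nat.log 2 (p + 1)) = ⊤ := by
  have h1 : ∑' p : ℕ, ((p + 2 : ℕ) : ℝ≥0∞)⁻¹ = ⊤ := by
    by_contra h
    have := ENNReal.summable_toReal h
    have h2 : Summable (fun p : ℕ => (((p + 2 : ℕ) : ℝ))⁻¹) := by
      refine this.congr fun p => ?_
      rw [ENNReal.toReal_inv, ENNReal.toReal_natCast]
    exact Real.not_summable_natCast_inv ((summable_nat_add_iff (f := fun n : ℕ => ((n : ℝ))⁻¹) 2).mp h2)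
  rw [← top_le_iff, tsum_eq_zero_add' ENNReal.summable, ← h1]
  refine le_add_left (ENNReal.tsum_le_tsum fun p => ?_)
  have hl : 1 ≤ Nat.log 2 (p + 1 + 1) := Nat.log_pos (by norm_num) (by omega)
  have hp : 2 ^ Nat.log 2 (p + 1 + 1) ≤ p + 2 := Nat.pow_log_le_self 2 (by omega)
  rw [← one_div]
  apply ENNReal.div_le_div
  · exact_mod_cast hl
  · exact_mod_cast hp

lemma aux_cap (s : ℕ → ℕ) (p : ℕ) (hp : 1 ≤ p) (hs : s p ≤ p) :
    (s p : ℝ≥0∞) / 2 ^ s p ≤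
    cap ({k : ℕ | ∃ p, 1 ≤ p ∧ 2 ^ p ≤ k ∧ k < 2 ^ (p + 1) ∧ s p ≤ nu k} ∩ Kblock p) / 2 ^ p := by
  set E := {k : ℕ | ∃ p, 1 ≤ p ∧ 2 ^ p ≤ k ∧ k < 2 ^ (p + 1) ∧ s p ≤ nu k} ∩ Kblock p with hE
  obtain ⟨d, hd⟩ := Nat.exists_eq_add_of_le hs
  have pos : 0 < 2 ^ s p := by positivity
  have facts : ∀ i : Fin (2 ^ d), (2 ^ s p * (2 ^ d + (i : ℕ) + 1) - 1) ∈ E ∧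
      s p ≤ nu (2 ^ s p * (2 ^ d + (i : ℕ) + 1) - 1) := by
    intro i
    have hi := i.2
    have e2 : 2 ^ p = 2 ^ s p * 2 ^ d := by rw [← pow_add, ← hd]
    have l1 : 2 ^ s p * (2 ^ d + 1) ≤ 2 ^ s p * (2 ^ d + (i : ℕ) + 1) :=
      Nat.mul_le_mul_left _ (by omega)
    have l2 : 2 ^ s p * (2 ^ d + (i : ℕ) + 1) ≤ 2 ^ s p * (2 ^ d * 2) :=
      Nat.mul_le_mul_left _ (by omega)
    have hnu : s p ≤ nu (2 ^ s p * (2 ^ d + (i : ℕ) + 1) - 1) := by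
      unfold nu
      rw [Nat.sub_add_cancel (Nat.succ_le_of_lt (by positivity))]
      rw [← padicValNat_dvd_iff_le (by positivity)]
      exact Dvd.intro _ rfl
    have b1 : 2 ^ p ≤ 2 ^ s p * (2 ^ d + (i : ℕ) + 1) - 1 := by
      rw [mul_add, mul_one] at l1; omega
    have b2 : 2 ^ s p * (2 ^ d + (i : ℕ) + 1) - 1 < 2 ^ (p + 1) := by
      have l3 : 0 < 2 ^ s p * 2 ^ d := by positivity
      rw [pow_succ, e2]; rw [← mul_assoc] at l2; omega
    exact ⟨⟨⟨p, hp, b1, b2, hnu⟩, b1, b2⟩, hnu⟩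
  let g : Fin (2 ^ d) → E := fun i => ⟨_, (facts i).1⟩
  have ginj : Function.Injective g := by
    intro i j hij
    have h := congrArg Subtype.val hij
    simp only [g] at h
    have h1 : 0 < 2 ^ s p * (2 ^ d + (i : ℕ) + 1) := by positivity
    have h2 : 0 < 2 ^ s p * (2 ^ d + (j : ℕ) + 1) := by positivity
    have h3 : 2 ^ s p * (2 ^ d + (i : ℕ) + 1) = 2 ^ s p * (2 ^ d + (j : ℕ) + 1) := by omega
    have h4 := Nat.eq_of_mul_eq_mul_left pos h3
    exact Fin.ext (by omega)
  have hc : (2 ^ d : ℝ≥0∞) * s p ≤ cap E := by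
    unfold cap
    calc (2 ^ d : ℝ≥0∞) * s p = ∑' i : Fin (2 ^ d), (s p : ℝ≥0∞) := by simp
      _ ≤ ∑' i : Fin (2 ^ d), (nu (g i) : ℝ≥0∞) :=
        ENNReal.tsum_le_tsum fun i => by exact_mod_cast (facts i).2
      _ ≤ _ := ENNReal.tsum_comp_le_tsum_of_injective ginj (fun k : E => (nu k : ℝ≥0∞))
  have e2 : (2 : ℝ≥0∞) ^ p = 2 ^ d * 2 ^ s p := by rw [← pow_add, add_comm, ← hd]
  calc (s p : ℝ≥0∞) / 2 ^ s p = (2 ^ d * s p) / (2 ^ d * 2 ^ s p) := by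
        rw [ENNReal.mul_div_mul_left _ _ (by positivity) (by simp)]
    _ ≤ cap E / 2 ^ p := by rw [e2]; exact ENNReal.div_le_div_right hc _

/-- Theorem 1: for a time-homogeneous two-state Markov chain `ξ` with everywhere nonzero
transition probabilities `π`, `π(0,0) ≠ π(1,1)` and `π(0,0) + π(1,1) ≠ 1`, for every state
`x ∈ {0,1}` and every `n` there is a sequence `s_p ≤ p`, `s_p → ∞`, with
`∑ s_p 2^{-s_p} = ∞` (so that `E = ⋃_{p≥1} {k ∈ K_p : ν(k) ≥ s_p}` is a thick set), such
that `P(ξ_n^{(k)} = x) → 1/2` as `k → ∞` along `E`. -/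
theorem markov_hdiff_thick_limit
    {Ω : Type*} [MeasurableSpace Ω] (P : Measure Ω) [IsProbabilityMeasure P]
    (ξ : ℕ → Ω → ℕ) (hmeas : ∀ n, Measurable (ξ n))
    (hval : ∀ n ω, ξ n ω = 0 ∨ ξ n ω = 1)
    (p0 : ℕ → ℝ≥0∞) (π : ℕ → ℕ → ℝ≥0∞)
    (hp0 : p0 0 + p0 1 = 1)
    (hπrow : ∀ x, x = 0 ∨ x = 1 → π x 0 + π x 1 = 1)
    (hjoint : ∀ n : ℕ, ∀ x : ℕ → ℕ, (∀ i, i ≤ n → x i = 0 ∨ x i = 1) →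
      P {ω | ∀ i, i ≤ n → ξ i ω = x i}
        = p0 (x 0) * ∏ i ∈ Finset.Icc 1 n, π (x (i - 1)) (x i))
    (hπne : ∀ x y, (x = 0 ∨ x = 1) → (y = 0 ∨ y = 1) → π x y ≠ 0)
    (hdiag : π 0 0 ≠ π 1 1)
    (hsum : π 0 0 + π 1 1 ≠ 1) :
    ∀ x, (x = 0 ∨ x = 1) → ∀ n : ℕ, ∃ s : ℕ → ℕ,
      (∀ p, 1 ≤ p → s p ≤ p) ∧
      Tendsto s atTop atTop ∧
      (∑' p : ℕ, (s (p + 1) : ℝ≥0∞) / 2 ^ s (p + 1) = ⊤) ∧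
      Thick {k : ℕ | ∃ p, 1 ≤ p ∧ 2 ^ p ≤ k ∧ k < 2 ^ (p + 1) ∧ s p ≤ nu k} ∧
      Tendsto (fun k : ℕ => P {ω | hdiffP ξ k n ω = x})
        (atTop ⊓ 𝓟 {k : ℕ | ∃ p, 1 ≤ p ∧ 2 ^ p ≤ k ∧ k < 2 ^ (p + 1) ∧ s p ≤ nu k})
        (nhds (1 / 2 : ℝ≥0∞)) := by
  intro x hx n
  have hsle : ∀ p, Nat.log 2 p ≤ p := fun p => Nat.log_le_self 2 p
  have hst : Tendsto (fun p => Nat.log 2 p) atTop atTop := by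
    rw [tendsto_atTop]
    intro b
    filter_upwards [eventually_ge_atTop (2 ^ b)] with p hp
    exact Nat.le_log_of_pow_le (by norm_num) hp
  refine ⟨fun p => Nat.log 2 p, fun p _ => hsle p, hst, aux_div, ?_, ?_⟩
  · unfold Thick Thin
    rw [not_not, ← top_le_iff, ← aux_div]
    exact ENNReal.tsum_le_tsum fun p => aux_cap (fun p => Nat.log 2 p) (p + 1) (by omega) (hsle _)
  · obtain ⟨r, hr0, hr1, hr⟩ := aux_bound P ξ hmeas hval p0 π hπrow hjoint hπne
    have half : (1 / 2 : ℝ≥0∞) = ENNReal.ofReal (1 / 2) := by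
      rw [ENNReal.ofReal_div_of_pos (by norm_num)]; simp
    rw [half]
    have hP : (fun k : ℕ => P {ω | hdiffP ξ k n ω = x})
        = fun k => ENNReal.ofReal (P {ω | hdiffP ξ k n ω = x}).toReal := by
      funext k
      rw [ENNReal.ofReal_toReal (measure_ne_top _ _)]
    rw [hP]
    apply ENNReal.tendsto_ofReal
    rw [Metric.tendsto_nhds]
    intro ε hε
    obtain ⟨t, ht⟩ := exists_pow_lt_of_lt_one hε hr1
    rw [eventually_inf_principal]
    filter_upwards [eventually_ge_atTop (2 ^ (2 ^ (2 * t + 1)))] with k hk hkE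
    obtain ⟨p, hp1, h1, h2, h3⟩ := hkE
    have hp : 2 ^ (2 * t + 1) ≤ p := by
      have := lt_of_le_of_lt hk h2
      have := (Nat.pow_lt_pow_iff_right (by norm_num : 1 < 2)).mp this
      omega
    have hl : 2 * t + 1 ≤ nu k := le_trans (Nat.le_log_of_pow_le (by norm_num) hp) h3
    have hb := hr n k t (hl.trans (Nat.lt_two_pow_self).le)
    rw [Real.dist_eq]
    exact lt_of_le_of_lt ((aux_prob P _ (aux_hdiff_meas ξ hmeas k n)
      (fun ω => aux_hdiff_val ξ hval ω k n) x hx).trans hb) ht
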